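/- arXiv:2105.07731 — 3 statements merged into one kernel-verified Lean document; each statement's English description precedes it below -/
import Mathlib

section
/- Let m₁, m₂, m₃, n ∈ ℕ. The number of words over the alphabet {1,2,3} with exactly m₁ occurrences of 1, m₂ occurrences of 2 and m₃ occurrences of 3 whose volume equals n is equal to the sum, over all binary words α over {1,2} with m₁ occurrences of 1 and m₂ occurrences of 2, and over all functions j : {0,…,m₂} → ℕ with j₀ + ⋯ + j_{m₂} = m₃ and Σ_{t=0}^{m₂} j_t · S_t(α) = n, of the product ∏_{t=0}^{m₂} C(j_t + a_t(α), j_t), where C(·,·) denotes the binomial coefficient. -/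
/-- `occPos w a t` is the position (index in `w`) of the (t+1)-th occurrence of the letter `a`
in the word `w` (defaulting to `w.length` if there are not that many occurrences). -/
def occPos {α : Type*} [DecidableEq α] (w : List α) (a : α) (t : ℕ) : ℕ :=
  (List.indexesOf a w).getD t w.length

/-- The volume of a word `w` over the alphabet {1,2,3} (encoded as `Fin 3`, letter j ↦ j−1),
with letter j occurring m_j times: the number of triples (x₁,x₂,x₃), 0 ≤ x_j < m_j, such that
the (x₃+1)-th occurrence of the letter 3 precedes the (x₂+1)-th occurrence of the letter 2,
which precedes the (x₁+1)-th occurrence of the letter 1. -/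
noncomputable def vol3 (m₁ m₂ m₃ : ℕ) (w : List (Fin 3)) : ℕ :=
  Nat.card {x : Fin m₁ × Fin m₂ × Fin m₃ //
    occPos w 2 x.2.2 < occPos w 1 x.2.1 ∧ occPos w 1 x.2.1 < occPos w 0 x.1}

/-- `gap2 α t` = a_t(α): the number of occurrences of the letter 1 (encoded `0 : Fin 2`)
lying in gap `t` of the binary word `α`, i.e. preceded by exactly `t` occurrences of the
letter 2 (encoded `1 : Fin 2`). -/
def gap2 (α : List (Fin 2)) (t : ℕ) : ℕ :=
  ∑ p : Fin α.length, if α.get p = 0 ∧ (α.take p.val).count 1 = t then 1 else 0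

/-- `Sval α t` = S_t(α): the number of pairs consisting of an occurrence of the letter 2 in α
that is not among the first `t` occurrences of 2, together with an occurrence of the letter 1
lying strictly after it in α. -/
noncomputable def Sval (α : List (Fin 2)) (t : ℕ) : ℕ :=
  Nat.card {pq : Fin α.length × Fin α.length //
    (pq.1 : ℕ) < (pq.2 : ℕ) ∧ α.get pq.1 = 1 ∧ α.get pq.2 = 0 ∧
      t ≤ (α.take pq.1.val).count 1}

/-- The binary word obtained from a word over {1,2,3} by deleting every letter 3. -/
def deleteThree : List (Fin 3) → List (Fin 2)
  | [] => []
  | a :: w => if a = 0 then 0 :: deleteThree w else if a = 1 then 1 :: deleteThree w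
      else deleteThree w

/-- The number of letters 3 lying in gap `t` of a word over {1,2,3}. -/
def gapThree : List (Fin 3) → ℕ → ℕ
  | [], _ => 0
  | a :: w, t => if a = 0 then gapThree w t
      else if a = 1 then (if t = 0 then 0 else gapThree w (t - 1))
      else gapThree w t + if t = 0 then 1 else 0

theorem count_zero_deleteThree (w : List (Fin 3)) :
    (deleteThree w).count 0 = w.count 0 := by
  induction w with
  | nil => rfl
  | cons a w ih => fin_cases a <;> simp [deleteThree, ih]

theorem count_one_deleteThree (w : List (Fin 3)) :
    (deleteThree w).count 1 = w.count 1 := by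
  induction w with
  | nil => rfl
  | cons a w ih => fin_cases a <;> simp [deleteThree, ih]

theorem sum_gapThree (w : List (Fin 3)) :
    ∑ t ∈ Finset.range (w.count 1 + 1), gapThree w t = w.count 2 := by
  induction w with
  | nil => simp [gapThree]
  | cons a w ih =>
    fin_cases a
    · simpa [gapThree] using ih
    · simpa [gapThree, Finset.sum_range_succ'] using ih
    · simpa [gapThree, Finset.sum_add_distrib] using ih

theorem gap2_nil (t : ℕ) : gap2 [] t = 0 := by simp [gap2]

theorem gap2_cons_zero (α : List (Fin 2)) (t : ℕ) :
    gap2 (0 :: α) t = gap2 α t + if t = 0 then 1 else 0 := by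
  unfold gap2
  rw [add_comm]
  refine (Fin.sum_univ_succ _).trans ?_
  simp [eq_comm]

theorem gap2_cons_one_zero (α : List (Fin 2)) : gap2 (1 :: α) 0 = 0 := by
  unfold gap2
  refine (Fin.sum_univ_succ _).trans ?_
  simp

theorem gap2_cons_one_succ (α : List (Fin 2)) (t : ℕ) :
    gap2 (1 :: α) (t + 1) = gap2 α t := by
  unfold gap2
  refine (Fin.sum_univ_succ _).trans ?_
  simp

theorem sum_get_eq_count {β : Type*} [DecidableEq β] (l : List β) (b : β) :
    (∑ p : Fin l.length, if l.get p = b then 1 else 0) = l.count b := by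
  induction l with
  | nil => simp
  | cons a l ih =>
    refine (Fin.sum_univ_succ _).trans ?_
    simp only [List.get_eq_getElem] at ih
    simp only [List.length_cons, List.get_eq_getElem, Fin.val_zero, List.getElem_cons_zero,
      Fin.val_succ, List.getElem_cons_succ, ih, List.count_cons, beq_iff_eq, add_comm]
    congr

theorem Sval_eq_sum (α : List (Fin 2)) (t : ℕ) :
    Sval α t = ∑ p : Fin α.length, ∑ q : Fin α.length,
      if (p : ℕ) < (q : ℕ) ∧ α.get p = 1 ∧ α.get q = 0 ∧ t ≤ (α.take p.val).count 1
      then 1 else 0 := by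
  rw [Sval, Nat.card_eq_fintype_card, Fintype.card_subtype, Finset.card_filter,
    Fintype.sum_prod_type]

theorem Sval_nil (t : ℕ) : Sval [] t = 0 := by simp [Sval_eq_sum]

theorem Sval_cons_zero (α : List (Fin 2)) (t : ℕ) : Sval (0 :: α) t = Sval α t := by
  rw [Sval_eq_sum, Sval_eq_sum]
  refine (Fin.sum_univ_succ _).trans ?_
  simp only [List.length_cons, Fin.sum_univ_succ]
  simp

theorem Sval_cons_one_zero (α : List (Fin 2)) :
    Sval (1 :: α) 0 = Sval α 0 + α.count 0 := by
  rw [Sval_eq_sum, Sval_eq_sum, ← sum_get_eq_count, add_comm]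
  refine (Fin.sum_univ_succ _).trans ?_
  simp only [List.length_cons, Fin.sum_univ_succ]
  simp

theorem Sval_cons_one_succ (α : List (Fin 2)) (t : ℕ) :
    Sval (1 :: α) (t + 1) = Sval α t := by
  rw [Sval_eq_sum, Sval_eq_sum]
  refine (Fin.sum_univ_succ _).trans ?_
  simp only [List.length_cons, Fin.sum_univ_succ]
  simp

theorem occPos_eq {β : Type*} [DecidableEq β] (w : List β) (a : β) (t : ℕ) :
    occPos w a t = (w.idxsOf a).getD t w.length := rfl

theorem occPos_cons_self_zero {β : Type*} [DecidableEq β] (w : List β) (a : β) :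
    occPos (a :: w) a 0 = 0 := by
  rw [occPos_eq, List.idxsOf_cons]
  simp

theorem occPos_cons_self_succ {β : Type*} [DecidableEq β] (w : List β) (a : β) (t : ℕ) :
    occPos (a :: w) a (t + 1) = occPos w a t + 1 := by
  rw [occPos_eq, occPos_eq, List.idxsOf_cons, List.idxsOf_start]
  simp

theorem occPos_cons_of_ne {β : Type*} [DecidableEq β] (w : List β) {a b : β} (h : b ≠ a)
    (t : ℕ) : occPos (b :: w) a t = occPos w a t + 1 := by
  rw [occPos_eq, occPos_eq, List.idxsOf_cons, List.idxsOf_start]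
  simp [h]

theorem sum_occPos_pairs (w : List (Fin 3)) :
    (∑ y ∈ Finset.range (w.count 1), ∑ x ∈ Finset.range (w.count 0),
      if occPos w 1 y < occPos w 0 x then 1 else 0) = Sval (deleteThree w) 0 := by
  induction w with
  | nil => simp [deleteThree, Sval_nil]
  | cons a w ih =>
    fin_cases a
    · simpa [deleteThree, Sval_cons_zero, Finset.sum_range_succ', occPos_cons_self_zero,
        occPos_cons_self_succ, occPos_cons_of_ne, -Finset.sum_boole] using ih
    · simp [deleteThree, Sval_cons_one_zero, Finset.sum_range_succ', occPos_cons_self_zero,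
        occPos_cons_self_succ, occPos_cons_of_ne, count_zero_deleteThree, ← ih, -Finset.sum_boole]
    · simpa [deleteThree, occPos_cons_of_ne] using ih

theorem sum_occPos_triples (w : List (Fin 3)) :
    (∑ z ∈ Finset.range (w.count 2), ∑ y ∈ Finset.range (w.count 1),
      ∑ x ∈ Finset.range (w.count 0),
        if occPos w 2 z < occPos w 1 y ∧ occPos w 1 y < occPos w 0 x then 1 else 0) =
      ∑ t ∈ Finset.range (w.count 1 + 1), gapThree w t * Sval (deleteThree w) t := by
  induction w with
  | nil => simp [gapThree]
  | cons a w ih =>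
    fin_cases a
    · simpa [deleteThree, gapThree, Sval_cons_zero, Finset.sum_range_succ',
        occPos_cons_self_zero, occPos_cons_self_succ, occPos_cons_of_ne,
        -Finset.sum_boole] using ih
    · simp [deleteThree, gapThree, Sval_cons_one_succ, Finset.sum_range_succ' _ (_ + 1),
        Finset.sum_range_succ' _ (w.count 1), occPos_cons_self_zero,
        occPos_cons_self_succ, occPos_cons_of_ne] at ih ⊢
      exact ih
    · simp [deleteThree, gapThree, Finset.sum_range_succ' _ (w.count 2), occPos_cons_self_zero,
        occPos_cons_self_succ, occPos_cons_of_ne, add_mul, Finset.sum_add_distrib, ih,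
        sum_occPos_pairs, -Finset.sum_boole]

theorem vol3_eq_sum (w : List (Fin 3)) :
    vol3 (w.count 0) (w.count 1) (w.count 2) w =
      ∑ t ∈ Finset.range (w.count 1 + 1), gapThree w t * Sval (deleteThree w) t := by
  rw [← sum_occPos_triples, vol3, Nat.card_eq_fintype_card, Fintype.card_subtype,
    Finset.card_filter, Fintype.sum_prod_type_right, Fintype.sum_prod_type_right]
  simp only [Finset.sum_range]

/-- The words over {1,2,3} which become `α` on deleting the letters 3 and which have `k`
letters 3 in gap `0` and `g t` letters 3 in gap `t + 1`. -/
def insertions (α : List (Fin 2)) (k : ℕ) (g : ℕ → ℕ) : Set (List (Fin 3)) :=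
  {w | deleteThree w = α ∧ gapThree w 0 = k ∧ ∀ t < α.count 1, gapThree w (t + 1) = g t}

theorem insertions_nil_zero (g : ℕ → ℕ) : insertions [] 0 g = {[]} := by
  ext w
  rcases w with _ | ⟨a, w⟩
  · simp [insertions, deleteThree, gapThree]
  · fin_cases a <;> simp [insertions, deleteThree, gapThree]

theorem insertions_nil_succ (k : ℕ) (g : ℕ → ℕ) :
    insertions [] (k + 1) g = List.cons 2 '' insertions [] k g := by
  ext w
  rcases w with _ | ⟨a, w⟩
  · simp [insertions, gapThree]
  · fin_cases a <;> simp [insertions, deleteThree, gapThree]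

theorem insertions_one_zero (α : List (Fin 2)) (g : ℕ → ℕ) :
    insertions (1 :: α) 0 g = List.cons 1 '' insertions α (g 0) (fun t => g (t + 1)) := by
  ext w
  rcases w with _ | ⟨a, w⟩
  · simp [insertions, deleteThree]
  · fin_cases a <;> simp [insertions, deleteThree, gapThree, Nat.forall_lt_succ_left',
      -Order.lt_add_one_iff]

theorem insertions_one_succ (α : List (Fin 2)) (k : ℕ) (g : ℕ → ℕ) :
    insertions (1 :: α) (k + 1) g = List.cons 2 '' insertions (1 :: α) k g := by
  ext w
  rcases w with _ | ⟨a, w⟩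
  · simp [insertions, deleteThree]
  · fin_cases a <;> simp [insertions, deleteThree, gapThree]

theorem insertions_zero_zero (α : List (Fin 2)) (g : ℕ → ℕ) :
    insertions (0 :: α) 0 g = List.cons 0 '' insertions α 0 g := by
  ext w
  rcases w with _ | ⟨a, w⟩
  · simp [insertions, deleteThree]
  · fin_cases a <;> simp [insertions, deleteThree, gapThree]

theorem insertions_zero_succ (α : List (Fin 2)) (k : ℕ) (g : ℕ → ℕ) :
    insertions (0 :: α) (k + 1) g =
      List.cons 0 '' insertions α (k + 1) g ∪ List.cons 2 '' insertions (0 :: α) k g := by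
  ext w
  rcases w with _ | ⟨a, w⟩
  · simp [insertions, deleteThree]
  · fin_cases a <;> simp [insertions, deleteThree, gapThree]

theorem finite_and_ncard_insertions (α : List (Fin 2)) (k : ℕ) (g : ℕ → ℕ) :
    (insertions α k g).Finite ∧ (insertions α k g).ncard =
      (k + gap2 α 0).choose k *
        ∏ t ∈ Finset.range (α.count 1), (g t + gap2 α (t + 1)).choose (g t) := by
  induction α generalizing k g with
  | nil =>
    induction k with
    | zero => simp [insertions_nil_zero]
    | succ k ih =>
      rw [insertions_nil_succ, Set.ncard_image_of_injective _ List.cons_injective]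
      refine ⟨ih.1.image _, ?_⟩
      simpa [gap2_nil] using ih.2
  | cons a α ihα =>
    fin_cases a
    · induction k with
      | zero =>
        simp only [Fin.zero_eta, insertions_zero_zero]
        rw [Set.ncard_image_of_injective _ List.cons_injective]
        refine ⟨(ihα 0 g).1.image _, ?_⟩
        simpa [gap2_cons_zero] using (ihα 0 g).2
      | succ k ih =>
        simp only [Fin.zero_eta, insertions_zero_succ] at ih ⊢
        have h1 := (ihα (k + 1) g).1.image (List.cons (0 : Fin 3))
        have h2 := ih.1.image (List.cons (2 : Fin 3))
        refine ⟨h1.union h2, ?_⟩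
        rw [Set.ncard_union_eq _ h1 h2, Set.ncard_image_of_injective _ List.cons_injective,
          Set.ncard_image_of_injective _ List.cons_injective, (ihα (k + 1) g).2, ih.2]
        · simp only [gap2_cons_zero, if_true, Nat.add_eq_zero_iff, one_ne_zero, and_false,
            if_false, add_zero, List.count_cons_of_ne (show (0 : Fin 2) ≠ 1 by decide)]
          rw [← add_mul, show k + 1 + (gap2 α 0 + 1) = (k + 1 + gap2 α 0) + 1 by ring,
            Nat.choose_succ_succ, show k + (gap2 α 0 + 1) = k + 1 + gap2 α 0 by ring, add_comm]
        · rw [Set.disjoint_left]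
          rintro _ ⟨u, _, rfl⟩ ⟨v, _, h⟩
          simp at h
    · induction k with
      | zero =>
        simp only [Fin.mk_one, insertions_one_zero]
        rw [Set.ncard_image_of_injective _ List.cons_injective]
        refine ⟨(ihα _ _).1.image _, ?_⟩
        simpa [gap2_cons_one_succ, Finset.prod_range_succ', mul_comm] using (ihα _ _).2
      | succ k ih =>
        simp only [Fin.mk_one, insertions_one_succ] at ih ⊢
        rw [Set.ncard_image_of_injective _ List.cons_injective]
        refine ⟨ih.1.image _, ?_⟩
        simpa [gap2_cons_one_zero] using ih.2

theorem ncard_deleteThree_gapThree_fiber {m : ℕ} (α : List (Fin 2)) (hα : α.count 1 = m)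
    (j : Fin (m + 1) → ℕ) :
    {w : List (Fin 3) | deleteThree w = α ∧ ∀ t : Fin (m + 1), gapThree w t = j t}.ncard =
      ∏ t, (j t + gap2 α t).choose (j t) := by
  subst hα
  have h := (finite_and_ncard_insertions α (j 0)
    (fun t => if ht : t < α.count 1 then j (Fin.succ ⟨t, ht⟩) else 0)).2
  simp only [Finset.prod_range, Fin.is_lt, dite_true, Fin.eta] at h
  rw [Fin.prod_univ_succ]
  refine Eq.trans ?_ h
  congr 1
  ext w
  simp only [insertions, Set.mem_ofPred_eq, Fin.forall_fin_succ (n := α.count 1)]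
  refine and_congr_right fun _ => and_congr Iff.rfl ⟨fun H t ht => ?_, fun H t => ?_⟩
  · simpa [ht] using H ⟨t, ht⟩
  · simpa using H t t.2

theorem length_eq_sum_count {β : Type*} [Fintype β] [DecidableEq β] (w : List β) :
    w.length = ∑ b, w.count b := by
  simpa using (Multiset.sum_count_eq_card (s := Finset.univ) (m := (w : Multiset β))
    (fun a _ => Finset.mem_univ a)).symm

theorem finite_setOf_count_eq {β : Type*} [Fintype β] [DecidableEq β] (m : β → ℕ) :
    {w : List β | ∀ b, w.count b = m b}.Finite := by
  refine (List.finite_length_eq β (∑ b, m b)).subset fun w hw => ?_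
  rw [Set.mem_ofPred_eq, length_eq_sum_count]
  exact Finset.sum_congr rfl fun b _ => hw b

theorem Set.Finite.ncard_eq_finsum_ncard_fiber {β γ : Type*} {s : Set β} {t : Set γ}
    (hs : s.Finite) (ht : t.Finite) (f : β → γ) (hf : Set.MapsTo f s t) :
    s.ncard = ∑ᶠ c ∈ t, {b ∈ s | f b = c}.ncard := by
  classical
  rw [finsum_mem_eq_finite_toFinset_sum _ ht, Set.ncard_eq_toFinset_card s hs,
    Finset.card_eq_sum_card_fiberwise (f := f) (t := ht.toFinset)
      (by simpa using hf)]
  refine Finset.sum_congr rfl fun c _ => ?_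
  rw [← Set.ncard_coe_finset]
  congr 1
  ext b
  simp

/-- the number of words over {1,2,3} with m₁, m₂, m₃ occurrences of 1, 2, 3 and
volume n is the sum over binary words α and over compositions j₀+⋯+j_{m₂} = m₃ with
Σ j_t·S_t(α) = n of ∏_t C(j_t + a_t(α), j_t). -/
theorem stmt2 (m₁ m₂ m₃ n : ℕ) :
    Set.ncard {w : List (Fin 3) |
        w.count 0 = m₁ ∧ w.count 1 = m₂ ∧ w.count 2 = m₃ ∧ vol3 m₁ m₂ m₃ w = n} =
      ∑ᶠ (α : List (Fin 2)) (_ : α.count 0 = m₁ ∧ α.count 1 = m₂),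
        ∑ᶠ (j : Fin (m₂ + 1) → ℕ)
            (_ : (∑ t, j t) = m₃ ∧ (∑ t, j t * Sval α t) = n),
          ∏ t, Nat.choose (j t + gap2 α t) (j t) := by
  have hW : {w : List (Fin 3) | w.count 0 = m₁ ∧ w.count 1 = m₂ ∧ w.count 2 = m₃ ∧
      vol3 m₁ m₂ m₃ w = n}.Finite := by
    refine (finite_setOf_count_eq ![m₁, m₂, m₃]).subset ?_
    rintro w ⟨h0, h1, h2, -⟩ b
    fin_cases b <;> simp [h0, h1, h2]
  have hA : {α : List (Fin 2) | α.count 0 = m₁ ∧ α.count 1 = m₂}.Finite := by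
    refine (finite_setOf_count_eq ![m₁, m₂]).subset ?_
    rintro w ⟨h0, h1⟩ b
    fin_cases b <;> simp [h0, h1]
  rw [hW.ncard_eq_finsum_ncard_fiber hA deleteThree]
  swap
  · rintro w ⟨h0, h1, -⟩
    exact ⟨(count_zero_deleteThree w).trans h0, (count_one_deleteThree w).trans h1⟩
  refine finsum_mem_congr rfl fun α hα => ?_
  obtain ⟨hα0, hα1⟩ := hα
  have hJ : {j : Fin (m₂ + 1) → ℕ | (∑ t, j t) = m₃ ∧ (∑ t, j t * Sval α t) = n}.Finite := by
    refine (Set.finite_Iic (fun _ => m₃)).subset ?_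
    rintro j ⟨h, -⟩ t
    exact h ▸ Finset.single_le_sum (f := j) (fun _ _ => Nat.zero_le _) (Finset.mem_univ t)
  have key : ∀ w : List (Fin 3), deleteThree w = α →
      ((w.count 0 = m₁ ∧ w.count 1 = m₂ ∧ w.count 2 = m₃ ∧ vol3 m₁ m₂ m₃ w = n) ↔
        (∑ t : Fin (m₂ + 1), gapThree w t) = m₃ ∧
          (∑ t : Fin (m₂ + 1), gapThree w t * Sval α t) = n) := by
    rintro w rfl
    rw [count_zero_deleteThree] at hα0
    rw [count_one_deleteThree] at hα1
    subst hα0 hα1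
    rw [← Finset.sum_range (fun t => gapThree w t), sum_gapThree,
      ← Finset.sum_range (fun t => gapThree w t * Sval (deleteThree w) t), ← vol3_eq_sum]
    constructor
    · rintro ⟨-, -, rfl, h⟩
      exact ⟨rfl, h⟩
    · rintro ⟨rfl, h⟩
      exact ⟨rfl, rfl, rfl, h⟩
  rw [(hW.subset (Set.sep_subset _ _)).ncard_eq_finsum_ncard_fiber hJ
    (fun w (t : Fin (m₂ + 1)) => gapThree w t)]
  swap
  · rintro w ⟨h, hw⟩
    exact (key w hw).1 h
  refine finsum_mem_congr rfl fun j hj => ?_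
  rw [← ncard_deleteThree_gapThree_fiber α hα1 j]
  congr 1
  ext w
  simp only [Set.mem_ofPred_eq, funext_iff]
  constructor
  · rintro ⟨⟨-, hw⟩, h⟩
    exact ⟨hw, h⟩
  · rintro ⟨hw, h⟩
    refine ⟨⟨(key w hw).2 ?_, hw⟩, h⟩
    simp only [h]
    exact hj
end

section
/- Let k ≥ 3 be an integer and r₀ a real number with 1/k < r₀ < 1/(k−1). Then: (i) for all 1 ≤ i ≤ k−3 and i+2 ≤ j ≤ k−1, every x ∈ L_i and y ∈ L_j satisfy |x − y| > r₀; (ii) for every 2 ≤ j ≤ k−1 and every y ∈ L_j, |y − 0| > r₀; and (iii) for every 1 ≤ i ≤ k−2 and every x ∈ L_i, |1 − x| > r₀. (Points in non-adjacent lenses, and the endpoints 0 and 1 with non-neighbouring lenses, are never adjacent in the geometric graph with connection range r₀.) -/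
/-- The j-th lens: intersection of the open balls B(0, j·r₀) and B(1, (k−j)·r₀) in ℝ. -/
def lens (k : ℕ) (r₀ : ℝ) (j : ℕ) : Set ℝ :=
  Metric.ball (0 : ℝ) ((j : ℝ) * r₀) ∩ Metric.ball (1 : ℝ) (((k : ℝ) - (j : ℝ)) * r₀)

/-- The `j`-th lens lies strictly between `1 - (k - j) * r₀` and `j * r₀`. -/
theorem bounds_of_mem_lens {k : ℕ} {r₀ : ℝ} {j : ℕ} {x : ℝ} (hx : x ∈ lens k r₀ j) :
    1 - ((k : ℝ) - j) * r₀ < x ∧ x < j * r₀ := by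
  obtain ⟨h₀, h₁⟩ := hx
  rw [Metric.mem_ball, Real.dist_eq, abs_lt] at h₀ h₁
  constructor <;> linarith [h₀.2, h₁.1]

/-- points in non-adjacent lenses, and the endpoints with non-neighbouring
lenses, are never adjacent in the geometric graph with connection range r₀. -/
theorem stmt13 (k : ℕ) (hk : 3 ≤ k) (r₀ : ℝ)
    (h1 : 1 / (k : ℝ) < r₀) (h2 : r₀ < 1 / ((k : ℝ) - 1)) :
    (∀ i j, 1 ≤ i → i ≤ k - 3 → i + 2 ≤ j → j ≤ k - 1 →
      ∀ x ∈ lens k r₀ i, ∀ y ∈ lens k r₀ j, r₀ < |x - y|) ∧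
    (∀ j, 2 ≤ j → j ≤ k - 1 → ∀ y ∈ lens k r₀ j, r₀ < |y - 0|) ∧
    (∀ i, 1 ≤ i → i ≤ k - 2 → ∀ x ∈ lens k r₀ i, r₀ < |1 - x|) := by
  have hk' : (3 : ℝ) ≤ k := by exact_mod_cast hk
  have hr : 0 < r₀ := lt_trans (by positivity) h1
  have hkr : r₀ * ((k : ℝ) - 1) < 1 := (lt_div_iff₀ (by linarith)).mp h2
  refine ⟨?_, ?_, ?_⟩
  · intro i j _ _ hij _ x hx y hy
    have hij' : (i : ℝ) + 2 ≤ j := by exact_mod_cast hij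
    have hmul := mul_le_mul_of_nonneg_right hij' hr.le
    rw [abs_sub_comm]
    refine lt_of_lt_of_le ?_ (le_abs_self _)
    linarith [(bounds_of_mem_lens hx).2, (bounds_of_mem_lens hy).1]
  · intro j hj _ y hy
    have hj' : (2 : ℝ) ≤ j := by exact_mod_cast hj
    have hmul := mul_le_mul_of_nonneg_right hj' hr.le
    refine lt_of_lt_of_le ?_ (le_abs_self _)
    linarith [(bounds_of_mem_lens hy).1]
  · intro i _ hi x hx
    have hi' : (i : ℝ) + 2 ≤ k := by
      have : i + 2 ≤ k := by omega
      exact_mod_cast this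
    have hmul := mul_le_mul_of_nonneg_right hi' hr.le
    refine lt_of_lt_of_le ?_ (le_abs_self _)
    linarith [(bounds_of_mem_lens hx).2]
end

section
/- Let k ≥ 2 be an integer and r₀ a real number with 1/k < r₀ < 1/(k−1). Let v₁, …, v_{k−1} be real numbers with v_j ∈ L_j for each j. Then |v₁ − 0| < r₀ and |1 − v_{k−1}| < r₀ hold automatically, and for every 1 ≤ j ≤ k−2 one has |v_{j+1} − v_j| < r₀ if and only if v_{j+1} − (1 − (k−j−1)·r₀) < v_j − (1 − (k−j)·r₀). Consequently, the sequence 0, v₁, …, v_{k−1}, 1 is a k-hop path with connection range r₀ if and only if the shifted values v_j − (1 − (k−j)·r₀) are strictly decreasing in j. -/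
/-- Points of consecutive lenses are in increasing order, so they are within range of each other
iff the shifted values decrease. -/
theorem abs_sub_lt_iff_shift_lt {k j : ℕ} {r₀ x y : ℝ} (hkr : ((k : ℝ) - 1) * r₀ < 1)
    (hx : x ∈ lens k r₀ j) (hy : y ∈ lens k r₀ (j + 1)) :
    |y - x| < r₀ ↔
      y - (1 - ((k : ℝ) - ((j : ℝ) + 1)) * r₀) < x - (1 - ((k : ℝ) - (j : ℝ)) * r₀) := by
  simp only [lens, Set.mem_inter_iff, Metric.mem_ball, Real.dist_eq, abs_lt, Nat.cast_add,
    Nat.cast_one] at hx hy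
  rw [abs_lt]
  constructor
  · rintro ⟨-, h⟩
    linarith
  · intro h
    constructor <;> linarith [hx.1.2, hy.2.1]

/-- for points v_j ∈ L_j, the end connections are automatic, consecutive
adjacency amounts to comparison of the shifted values v_j − (1 − (k−j)r₀), and the sequence
0, v₁, …, v_{k−1}, 1 is a k-hop path iff the shifted values are strictly decreasing in j. -/
theorem stmt14 (k : ℕ) (hk : 2 ≤ k) (r₀ : ℝ)
    (h1 : 1 / (k : ℝ) < r₀) (h2 : r₀ < 1 / ((k : ℝ) - 1))
    (v : ℕ → ℝ) (hv : ∀ j, 1 ≤ j → j ≤ k - 1 → v j ∈ lens k r₀ j) :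
    |v 1 - 0| < r₀ ∧ |1 - v (k - 1)| < r₀ ∧
    (∀ j, 1 ≤ j → j ≤ k - 2 →
      (|v (j + 1) - v j| < r₀ ↔
        v (j + 1) - (1 - ((k : ℝ) - ((j : ℝ) + 1)) * r₀) < v j - (1 - ((k : ℝ) - (j : ℝ)) * r₀))) ∧
    ((∀ i < k,
        |(if i + 1 = 0 then (0:ℝ) else if i + 1 = k then 1 else v (i + 1)) -
          (if i = 0 then (0:ℝ) else if i = k then 1 else v i)| < r₀) ↔
      (∀ i j, 1 ≤ i → i < j → j ≤ k - 1 →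
        v j - (1 - ((k : ℝ) - (j : ℝ)) * r₀) < v i - (1 - ((k : ℝ) - (i : ℝ)) * r₀))) := by
  have hk' : (2 : ℝ) ≤ k := by exact_mod_cast hk
  have hkr : ((k : ℝ) - 1) * r₀ < 1 := by
    rw [lt_div_iff₀ (by linarith)] at h2
    linarith
  have hfirst : |v 1 - 0| < r₀ := by
    simpa [Real.dist_eq] using (hv 1 le_rfl (by omega)).1
  have hlast : |1 - v (k - 1)| < r₀ := by
    have h := (hv (k - 1) (by omega) le_rfl).2
    rw [Metric.mem_ball, Real.dist_eq, abs_sub_comm, Nat.cast_sub (by omega)] at h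
    simpa using h
  have hstep : ∀ j, 1 ≤ j → j ≤ k - 2 →
      (|v (j + 1) - v j| < r₀ ↔
        v (j + 1) - (1 - ((k : ℝ) - ((j : ℝ) + 1)) * r₀) <
          v j - (1 - ((k : ℝ) - (j : ℝ)) * r₀)) := fun j hj hjk =>
    abs_sub_lt_iff_shift_lt hkr (hv j hj (by omega)) (hv (j + 1) (by omega) (by omega))
  refine ⟨hfirst, hlast, hstep, fun hpath i j hi hij => ?_, fun hdec i hik => ?_⟩
  · have hnext : ∀ m, 1 ≤ m → m + 1 ≤ k - 1 →
        v (m + 1) - (1 - ((k : ℝ) - ((m + 1 : ℕ) : ℝ)) * r₀) <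
          v m - (1 - ((k : ℝ) - (m : ℝ)) * r₀) := by
      intro m hm hmk
      have h := hpath m (by omega)
      rw [if_neg (by omega), if_neg (by omega), if_neg (by omega), if_neg (by omega)] at h
      simpa only [Nat.cast_add, Nat.cast_one] using (hstep m hm (by omega)).1 h
    induction j, hij using Nat.le_induction with
    | base => exact hnext i hi
    | succ m hm ih => exact fun hmk => (hnext m (by omega) hmk).trans (ih (by omega))
  · rw [if_neg (Nat.succ_ne_zero i)]
    rcases Nat.eq_zero_or_pos i with rfl | hi
    · rw [if_neg (by omega), if_pos rfl]
      exact hfirst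
    rw [if_neg hi.ne', if_neg hik.ne]
    split_ifs with hlast_index
    · rwa [show i = k - 1 by omega]
    · refine (hstep i hi (by omega)).2 ?_
      simpa only [Nat.cast_add, Nat.cast_one] using
        hdec i (i + 1) hi i.lt_succ_self (by omega)
end
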